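/- Under the SVARM model with K ≥ 1 main-loop pairs and T̄ = 2K, the mean squared error of any player's Shapley value estimate is bounded by E[(φ̂_i − φ_i)²] ≤ (2Hₙ/T̄)·(σ_i⁺² + σ_i⁻²) (Corollary 4.3). -/

import Mathlib

open Finset
open scoped Classical

noncomputable section

/-- The `n`-th harmonic number `Hₙ = ∑_{k=1}^n 1/k`. -/
def harm (n : ℕ) : ℝ := ∑ k ∈ Finset.range n, (1 : ℝ) / (k + 1)

/-- The player set `N_i = N \ {i}`. -/
def Ni (n : ℕ) (i : Fin n) : Finset (Fin n) := Finset.univ.erase i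

/-- The Shapley weights `w_S = 1/(n·C(n−1,|S|))` (defining `P^w` on subsets of `N_i`). -/
def wgt (n : ℕ) (S : Finset (Fin n)) : ℝ :=
  1 / ((n : ℝ) * (Nat.choose (n - 1) S.card : ℝ))

/-- The SVARM sampling distribution `P⁺(S) = 1/(|S|·C(n,|S|)·Hₙ)` on nonempty `S ⊆ N`
(the formula evaluates to `0` on `S = ∅` by division-by-zero conventions). -/
def Pplus (n : ℕ) (S : Finset (Fin n)) : ℝ :=
  1 / ((S.card : ℝ) * (Nat.choose n S.card : ℝ) * harm n)

/-- The SVARM sampling distribution `P⁻(S) = 1/((n−|S|)·C(n,|S|)·Hₙ)` on proper `S ⊊ N`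
(the formula evaluates to `0` on `S = N` by division-by-zero conventions). -/
def Pminus (n : ℕ) (S : Finset (Fin n)) : ℝ :=
  1 / (((n : ℝ) - (S.card : ℝ)) * (Nat.choose n S.card : ℝ) * harm n)

/-- Sample space of SVARM with `K` main-loop pairs: warm-up samples `B⁺, B⁻` and main
samples `A₁⁺,…,A_K⁺`, `A₁⁻,…,A_K⁻`. -/
abbrev Omega (n K : ℕ) :=
  Finset (Fin n) × Finset (Fin n) × (Fin K → Finset (Fin n)) × (Fin K → Finset (Fin n))

/-- Joint pmf of the mutually independent samples `B⁺, B⁻ ∼ P^w` (subsets of `N_i`),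
`A₁⁺,…,A_K⁺` i.i.d. `∼ P⁺` and `A₁⁻,…,A_K⁻` i.i.d. `∼ P⁻`. -/
def jointP (n K : ℕ) (i : Fin n) (ω : Omega n K) : ℝ :=
  (if ω.1 ⊆ Ni n i then wgt n ω.1 else 0) *
    (if ω.2.1 ⊆ Ni n i then wgt n ω.2.1 else 0) *
    (∏ k, Pplus n (ω.2.2.1 k)) * (∏ k, Pminus n (ω.2.2.2 k))

/-- Expectation with respect to the joint distribution of the SVARM samples. -/
def expVal (n K : ℕ) (i : Fin n) (f : Omega n K → ℝ) : ℝ :=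
  ∑ ω : Omega n K, jointP n K i ω * f ω

/-- Probability of an event under the joint distribution of the SVARM samples. -/
def probEvent (n K : ℕ) (i : Fin n) (E : Omega n K → Prop) : ℝ :=
  ∑ ω : Omega n K, if E ω then jointP n K i ω else 0

/-- The sample count `m_i⁺ = 1 + #{k : i ∈ A_k⁺}`. -/
def mplus (n K : ℕ) (i : Fin n) (ω : Omega n K) : ℕ :=
  1 + (Finset.univ.filter fun k => i ∈ ω.2.2.1 k).card

/-- The sample count `m_i⁻ = 1 + #{k : i ∉ A_k⁻}`. -/
def mminus (n K : ℕ) (i : Fin n) (ω : Omega n K) : ℕ :=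
  1 + (Finset.univ.filter fun k => i ∉ ω.2.2.2 k).card

/-- The estimate `φ̂_i⁺ = (ν(B⁺ ∪ {i}) + ∑_{k : i ∈ A_k⁺} ν(A_k⁺))/m_i⁺`. -/
def phiHatPlus (n K : ℕ) (ν : Finset (Fin n) → ℝ) (i : Fin n) (ω : Omega n K) : ℝ :=
  (ν (insert i ω.1) + ∑ k ∈ Finset.univ.filter (fun k => i ∈ ω.2.2.1 k), ν (ω.2.2.1 k)) /
    (mplus n K i ω : ℝ)

/-- The estimate `φ̂_i⁻ = (ν(B⁻) + ∑_{k : i ∉ A_k⁻} ν(A_k⁻))/m_i⁻`. -/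
def phiHatMinus (n K : ℕ) (ν : Finset (Fin n) → ℝ) (i : Fin n) (ω : Omega n K) : ℝ :=
  (ν ω.2.1 + ∑ k ∈ Finset.univ.filter (fun k => i ∉ ω.2.2.2 k), ν (ω.2.2.2 k)) /
    (mminus n K i ω : ℝ)

/-- The SVARM estimator `φ̂_i = φ̂_i⁺ − φ̂_i⁻`. -/
def phiHat (n K : ℕ) (ν : Finset (Fin n) → ℝ) (i : Fin n) (ω : Omega n K) : ℝ :=
  phiHatPlus n K ν i ω - phiHatMinus n K ν i ω

/-- The Shapley value `φ_i = ∑_{S ⊆ N_i} w_S (ν(S∪{i}) − ν(S))`. -/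
def shapley (n : ℕ) (ν : Finset (Fin n) → ℝ) (i : Fin n) : ℝ :=
  ∑ S ∈ (Ni n i).powerset, wgt n S * (ν (insert i S) - ν S)

/-- The positive Shapley value `φ_i⁺ = E[ν(A ∪ {i})]` for `A ∼ P^w`. -/
def phiPlus (n : ℕ) (ν : Finset (Fin n) → ℝ) (i : Fin n) : ℝ :=
  ∑ S ∈ (Ni n i).powerset, wgt n S * ν (insert i S)

/-- The negative Shapley value `φ_i⁻ = E[ν(A)]` for `A ∼ P^w`. -/
def phiMinus (n : ℕ) (ν : Finset (Fin n) → ℝ) (i : Fin n) : ℝ :=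
  ∑ S ∈ (Ni n i).powerset, wgt n S * ν S

/-- The variance `σ_i⁺² = Var[ν(A ∪ {i})]` for `A ∼ P^w`. -/
def sigPlusSq (n : ℕ) (ν : Finset (Fin n) → ℝ) (i : Fin n) : ℝ :=
  ∑ S ∈ (Ni n i).powerset, wgt n S * (ν (insert i S) - phiPlus n ν i) ^ 2

/-- The variance `σ_i⁻² = Var[ν(A)]` for `A ∼ P^w`. -/
def sigMinusSq (n : ℕ) (ν : Finset (Fin n) → ℝ) (i : Fin n) : ℝ :=
  ∑ S ∈ (Ni n i).powerset, wgt n S * (ν S - phiMinus n ν i) ^ 2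

end

lemma sum_nonneg_of_zero_or_one {α : Type*} {d : α → ℝ} (hd : ∀ a, d a = 0 ∨ d a = 1) {K : ℕ}
    (A : Fin K → α) :
    0 ≤ ∑ k, d (A k) :=
  Finset.sum_nonneg fun k _ => by rcases hd (A k) with h | h <;> simp [h]

section ProductExpectation

variable {α : Type*} [Fintype α]

/-- The sum of `F` over `K`-tuples weighted by the product of the weights `P`: the expectation of
`F` on `K` i.i.d. samples when `P` is a probability mass function. -/
def prodExp (P : α → ℝ) {K : ℕ} (F : (Fin K → α) → ℝ) : ℝ :=
  ∑ A : Fin K → α, (∏ k, P (A k)) * F A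

lemma prodExp_succ (P : α → ℝ) {K : ℕ} (k : Fin (K + 1)) (F : (Fin (K + 1) → α) → ℝ) :
    prodExp P F = ∑ a, P a * prodExp P (fun A : Fin K → α => F (k.insertNth a A)) := by
  unfold prodExp
  rw [← (Fin.insertNthEquiv (fun _ => α) k).sum_comp, Fintype.sum_prod_type]
  refine Finset.sum_congr rfl fun a _ => ?_
  rw [Finset.mul_sum]
  refine Finset.sum_congr rfl fun A _ => ?_
  simp [Fin.insertNthEquiv, Fin.prod_univ_succAbove _ k, mul_assoc]

lemma prodExp_zero (P : α → ℝ) (F : (Fin 0 → α) → ℝ) : prodExp P F = F default := by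
  simp [prodExp]

lemma prodExp_add (P : α → ℝ) {K : ℕ} (F G : (Fin K → α) → ℝ) :
    prodExp P (fun A => F A + G A) = prodExp P F + prodExp P G := by
  simp [prodExp, mul_add, Finset.sum_add_distrib]

lemma prodExp_const_mul (P : α → ℝ) {K : ℕ} (c : ℝ) (F : (Fin K → α) → ℝ) :
    prodExp P (fun A => c * F A) = c * prodExp P F := by
  simp only [prodExp, Finset.mul_sum]
  exact Finset.sum_congr rfl fun A _ => by ring

lemma prodExp_sum (P : α → ℝ) {K : ℕ} {ι : Type*} (s : Finset ι) (F : ι → (Fin K → α) → ℝ) :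
    prodExp P (fun A => ∑ j ∈ s, F j A) = ∑ j ∈ s, prodExp P (F j) := by
  simp only [prodExp, Finset.mul_sum]
  exact Finset.sum_comm

lemma prodExp_one {P : α → ℝ} (hP : ∑ a, P a = 1) (K : ℕ) :
    prodExp P (fun _ : Fin K → α => (1 : ℝ)) = 1 := by
  induction K with
  | zero => rw [prodExp_zero]
  | succ K ih => rw [prodExp_succ P 0]; simp [ih, hP]

lemma prodExp_mono {P : α → ℝ} (hP : ∀ a, 0 ≤ P a) {K : ℕ} {F G : (Fin K → α) → ℝ}
    (h : ∀ A, F A ≤ G A) : prodExp P F ≤ prodExp P G :=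
  Finset.sum_le_sum fun A _ =>
    mul_le_mul_of_nonneg_left (h A) (Finset.prod_nonneg fun _ _ => hP _)

variable {P d t : α → ℝ}

lemma prodExp_mul_sum_eq_zero (hd : ∀ a, d a = 0 ∧ t a = 0 ∨ d a = 1)
    (ht : ∑ a, P a * t a = 0) (K : ℕ) (f : ℝ → ℝ) :
    prodExp P (fun A : Fin K → α => f (∑ k, d (A k)) * ∑ k, t (A k)) = 0 := by
  induction K generalizing f with
  | zero => simp [prodExp_zero]
  | succ K ih =>
    rw [prodExp_succ P 0]
    have key : ∀ a, prodExp P (fun A : Fin K → α =>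
          f (∑ k, d (Fin.insertNth (α := fun _ => α) 0 a A k)) *
            ∑ k, t (Fin.insertNth (α := fun _ => α) 0 a A k)) =
        t a * prodExp P (fun A : Fin K → α => f (1 + ∑ k, d (A k))) := by
      intro a
      have h := ih fun x => f (d a + x)
      have h2 : ∀ A : Fin K → α,
          f (∑ k, d (Fin.insertNth (α := fun _ => α) 0 a A k)) *
            ∑ k, t (Fin.insertNth (α := fun _ => α) 0 a A k) =
          t a * f (1 + ∑ k, d (A k)) + f (d a + ∑ k, d (A k)) * ∑ k, t (A k) := by
        intro A
        simp only [Fin.sum_univ_succAbove _ (0 : Fin (K + 1)), Fin.insertNth_apply_same,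
          Fin.insertNth_apply_succAbove]
        rcases hd a with ⟨_, h0⟩ | h1
        · simp [h0]
        · simp only [h1]; ring
      simp only [h2, prodExp_add, prodExp_const_mul, h, add_zero]
    simp only [key, ← mul_assoc]
    rw [← Finset.sum_mul, ht, zero_mul]

lemma prodExp_mul_sum_sq {v : ℝ} (hd : ∀ a, d a = 0 ∧ t a = 0 ∨ d a = 1)
    (ht : ∑ a, P a * t a = 0) (ht2 : ∑ a, P a * t a ^ 2 = v * ∑ a, P a * d a)
    (K : ℕ) (f : ℝ → ℝ) :
    prodExp P (fun A : Fin K → α => f (∑ k, d (A k)) * (∑ k, t (A k)) ^ 2) =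
      v * prodExp P (fun A : Fin K → α => f (∑ k, d (A k)) * ∑ k, d (A k)) := by
  induction K generalizing f with
  | zero => simp [prodExp_zero]
  | succ K ih =>
    rw [prodExp_succ P 0, prodExp_succ P 0]
    have key : ∀ a, prodExp P (fun A : Fin K → α =>
          f (∑ k, d (Fin.insertNth (α := fun _ => α) 0 a A k)) *
            (∑ k, t (Fin.insertNth (α := fun _ => α) 0 a A k)) ^ 2) =
        t a ^ 2 * prodExp P (fun A : Fin K → α => f (1 + ∑ k, d (A k))) +
        v * prodExp P (fun A : Fin K → α => f (d a + ∑ k, d (A k)) * ∑ k, d (A k)) := by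
      intro a
      have h := ih fun x => f (d a + x)
      have h0 := prodExp_mul_sum_eq_zero hd ht K fun x => f (d a + x)
      have h2 : ∀ A : Fin K → α,
          f (∑ k, d (Fin.insertNth (α := fun _ => α) 0 a A k)) *
            (∑ k, t (Fin.insertNth (α := fun _ => α) 0 a A k)) ^ 2 =
          t a ^ 2 * f (1 + ∑ k, d (A k)) +
            (2 * t a * (f (d a + ∑ k, d (A k)) * ∑ k, t (A k)) +
              f (d a + ∑ k, d (A k)) * (∑ k, t (A k)) ^ 2) := by
        intro A
        simp only [Fin.sum_univ_succAbove _ (0 : Fin (K + 1)), Fin.insertNth_apply_same,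
          Fin.insertNth_apply_succAbove]
        rcases hd a with ⟨_, h0⟩ | h1
        · simp [h0]
        · simp only [h1]; ring
      simp only [h2, prodExp_add, prodExp_const_mul, h, h0, mul_zero, zero_add]
    have key' : ∀ a, prodExp P (fun A : Fin K → α =>
          f (∑ k, d (Fin.insertNth (α := fun _ => α) 0 a A k)) *
            ∑ k, d (Fin.insertNth (α := fun _ => α) 0 a A k)) =
        d a * prodExp P (fun A : Fin K → α => f (1 + ∑ k, d (A k))) +
        prodExp P (fun A : Fin K → α => f (d a + ∑ k, d (A k)) * ∑ k, d (A k)) := by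
      intro a
      rw [← prodExp_const_mul, ← prodExp_add]
      congr 1
      funext A
      simp only [Fin.sum_univ_succAbove _ (0 : Fin (K + 1)), Fin.insertNth_apply_same,
          Fin.insertNth_apply_succAbove]
      rcases hd a with ⟨h1, _⟩ | h1 <;> rw [h1] <;> ring
    simp only [key, key', mul_add, Finset.sum_add_distrib]
    congr 1
    · simp only [← mul_assoc]
      rw [← Finset.sum_mul, ht2, mul_assoc, Finset.sum_mul]
    · rw [Finset.mul_sum]
      exact Finset.sum_congr rfl fun a _ => by ring

/-- `(K + 1) · p · E[1 / (1 + M)] ≤ 1` when `M` is binomial with parameters `K` and `p`. -/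
lemma prodExp_inv_one_add_le (hP : ∀ a, 0 ≤ P a) (hP1 : ∑ a, P a = 1)
    (hd : ∀ a, d a = 0 ∨ d a = 1) (K : ℕ) :
    (K + 1) * ((∑ a, P a * d a) * prodExp P (fun A : Fin K → α => 1 / (1 + ∑ k, d (A k)))) ≤ 1 := by
  have key : ∀ k : Fin (K + 1),
      prodExp P (fun A : Fin (K + 1) → α => d (A k) / ∑ l, d (A l)) =
        (∑ a, P a * d a) * prodExp P (fun A : Fin K → α => 1 / (1 + ∑ k, d (A k))) := by
    intro k
    rw [prodExp_succ P k, Finset.sum_mul]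
    refine Finset.sum_congr rfl fun a _ => ?_
    rw [mul_assoc]
    congr 1
    rw [← prodExp_const_mul]
    congr 1
    funext A
    simp only [Fin.sum_univ_succAbove _ k, Fin.insertNth_apply_same,
      Fin.insertNth_apply_succAbove]
    rcases hd a with h | h <;> simp [h]
  calc (K + 1) * ((∑ a, P a * d a) *
        prodExp P (fun A : Fin K → α => 1 / (1 + ∑ k, d (A k))))
      = prodExp P (fun A : Fin (K + 1) → α => ∑ k, d (A k) / ∑ l, d (A l)) := by
        rw [prodExp_sum]; simp [key]
    _ ≤ prodExp P (fun _ : Fin (K + 1) → α => (1 : ℝ)) :=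
        prodExp_mono hP fun A => by
          rw [← Finset.sum_div]; exact div_self_le_one _
    _ = 1 := prodExp_one hP1 _

variable {β : Type*} [Fintype β] {w h : β → ℝ}

lemma sum_prodExp_mean_eq_zero (hd : ∀ a, d a = 0 ∧ t a = 0 ∨ d a = 1)
    (ht : ∑ a, P a * t a = 0) (hh : ∑ b, w b * h b = 0) (K : ℕ) :
    ∑ b, w b * prodExp P
      (fun A : Fin K → α => (h b + ∑ k, t (A k)) / (1 + ∑ k, d (A k))) = 0 := by
  have h0 := prodExp_mul_sum_eq_zero hd ht K fun x => 1 / (1 + x)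
  have h2 : ∀ b, prodExp P
      (fun A : Fin K → α => (h b + ∑ k, t (A k)) / (1 + ∑ k, d (A k))) =
      h b * prodExp P (fun A : Fin K → α => 1 / (1 + ∑ k, d (A k))) := by
    intro b
    rw [← add_zero (h b * _), ← h0, ← prodExp_const_mul, ← prodExp_add]
    congr 1
    funext A
    ring
  simp only [h2, ← mul_assoc]
  rw [← Finset.sum_mul, hh, zero_mul]

lemma sum_prodExp_sq_mean_eq {v : ℝ} (hd : ∀ a, d a = 0 ∧ t a = 0 ∨ d a = 1)
    (ht : ∑ a, P a * t a = 0) (ht2 : ∑ a, P a * t a ^ 2 = v * ∑ a, P a * d a)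
    (hw : ∑ b, w b = 1) (hh2 : ∑ b, w b * h b ^ 2 = v) (K : ℕ) :
    ∑ b, w b * prodExp P
      (fun A : Fin K → α => ((h b + ∑ k, t (A k)) / (1 + ∑ k, d (A k))) ^ 2) =
      v * prodExp P (fun A : Fin K → α => 1 / (1 + ∑ k, d (A k))) := by
  have h0 := prodExp_mul_sum_eq_zero hd ht K fun x => 1 / (1 + x) ^ 2
  have hs := prodExp_mul_sum_sq hd ht ht2 K fun x => 1 / (1 + x) ^ 2
  have h2 : ∀ b, prodExp P
      (fun A : Fin K → α => ((h b + ∑ k, t (A k)) / (1 + ∑ k, d (A k))) ^ 2) =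
      h b ^ 2 * prodExp P (fun A : Fin K → α => 1 / (1 + ∑ k, d (A k)) ^ 2) +
        v * prodExp P
          (fun A : Fin K → α => 1 / (1 + ∑ k, d (A k)) ^ 2 * ∑ k, d (A k)) := by
    intro b
    rw [← hs, ← add_zero (h b ^ 2 * _), ← mul_zero (2 * h b), ← h0, ← prodExp_const_mul,
      ← prodExp_const_mul, ← prodExp_add, ← prodExp_add]
    congr 1
    funext A
    rw [div_pow]
    ring
  simp only [h2, mul_add, Finset.sum_add_distrib]
  simp only [← mul_assoc]
  rw [← Finset.sum_mul, hh2, ← Finset.sum_mul, ← Finset.sum_mul, hw, one_mul, ← mul_add,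
    ← prodExp_add]
  congr 2
  funext A
  have : 0 ≤ ∑ k, d (A k) := sum_nonneg_of_zero_or_one (fun a => (hd a).imp_left And.left) A
  field_simp

/-- The mean squared error of a sample mean of a warm-up draw of variance `v` and the accepted
draws among `K` i.i.d. ones, each accepted with probability `p`. -/
lemma sum_prodExp_sq_mean_le {v p : ℝ} (hP : ∀ a, 0 ≤ P a) (hP1 : ∑ a, P a = 1)
    (hd : ∀ a, d a = 0 ∧ t a = 0 ∨ d a = 1)
    (ht : ∑ a, P a * t a = 0) (hp : ∑ a, P a * d a = p) (hp0 : 0 < p)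
    (ht2 : ∑ a, P a * t a ^ 2 = v * p) (hv : 0 ≤ v)
    (hw : ∑ b, w b = 1) (hh2 : ∑ b, w b * h b ^ 2 = v)
    {K : ℕ} (hK : 1 ≤ K) :
    ∑ b, w b * prodExp P
      (fun A : Fin K → α => ((h b + ∑ k, t (A k)) / (1 + ∑ k, d (A k))) ^ 2) ≤
      v / (K * p) := by
  rw [sum_prodExp_sq_mean_eq hd ht (hp ▸ ht2) hw hh2, div_eq_mul_one_div]
  refine mul_le_mul_of_nonneg_left ?_ hv
  have hd' : ∀ a, d a = 0 ∨ d a = 1 := fun a => (hd a).imp_left And.left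
  have hb := prodExp_inv_one_add_le hP hP1 hd' K
  rw [hp] at hb
  have hnn : 0 ≤ prodExp P (fun A : Fin K → α => 1 / (1 + ∑ k, d (A k))) :=
    Finset.sum_nonneg fun A _ => mul_nonneg (Finset.prod_nonneg fun _ _ => hP _) <| by
      have := sum_nonneg_of_zero_or_one hd' A
      positivity
  have hK0 : (0 : ℝ) < K := by exact_mod_cast hK
  rw [le_div_iff₀ (by positivity)]
  nlinarith [mul_nonneg hp0.le hnn]

end ProductExpectation

lemma sum_mul_sub_sq_of_mean_zero {β γ : Type*} [Fintype β] [Fintype γ] {F X : β → ℝ}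
    {G Y : γ → ℝ} (hF : ∑ x, F x = 1) (hG : ∑ y, G y = 1) (hX : ∑ x, F x * X x = 0) :
    ∑ x, ∑ y, F x * G y * (X x - Y y) ^ 2 = ∑ x, F x * X x ^ 2 + ∑ y, G y * Y y ^ 2 := by
  have h : ∀ x, ∑ y, F x * G y * (X x - Y y) ^ 2 =
      F x * X x ^ 2 * ∑ y, G y + F x * ∑ y, G y * Y y ^ 2 -
        F x * X x * (2 * ∑ y, G y * Y y) := by
    intro x
    simp only [Finset.mul_sum, ← Finset.sum_add_distrib, ← Finset.sum_sub_distrib]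
    exact Finset.sum_congr rfl fun y _ => by ring
  simp only [h, Finset.sum_sub_distrib, Finset.sum_add_distrib, ← Finset.sum_mul]
  rw [hF, hG, hX]
  ring

/-- The probability mass function of `P^w` as a function on all subsets of `N`. -/
noncomputable def warmupP (n : ℕ) (i : Fin n) (S : Finset (Fin n)) : ℝ :=
  if S ⊆ Ni n i then wgt n S else 0

lemma sum_warmupP_mul (n : ℕ) (i : Fin n) (f : Finset (Fin n) → ℝ) :
    ∑ S, warmupP n i S * f S = ∑ S ∈ (Ni n i).powerset, wgt n S * f S := by
  simp only [warmupP, ite_mul, zero_mul, ← Finset.sum_filter]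
  refine Finset.sum_congr ?_ fun _ _ => rfl
  ext S
  simp

lemma card_Ni (n : ℕ) (i : Fin n) : (Ni n i).card = n - 1 := by
  simp [Ni]

lemma notMem_of_mem_powerset_Ni {n : ℕ} {i : Fin n} {S : Finset (Fin n)}
    (hS : S ∈ (Ni n i).powerset) : i ∉ S := fun h => by
  simpa [Ni] using Finset.mem_powerset.1 hS h

lemma card_add_one_le_of_mem_powerset_Ni {n : ℕ} {i : Fin n} {S : Finset (Fin n)}
    (hS : S ∈ (Ni n i).powerset) : S.card + 1 ≤ n := by
  have h := Finset.card_le_card (Finset.mem_powerset.1 hS)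
  rw [card_Ni] at h
  have := i.pos
  omega

lemma sum_wgt (n : ℕ) (i : Fin n) : ∑ S ∈ (Ni n i).powerset, wgt n S = 1 := by
  have hn := i.pos
  have h := Finset.sum_powerset_apply_card
    (fun m => 1 / ((n : ℝ) * (Nat.choose (n - 1) m : ℝ))) (x := Ni n i)
  unfold wgt
  rw [h, card_Ni, Nat.sub_add_cancel hn]
  have : ∀ m ∈ Finset.range n,
      (n - 1).choose m • (1 / ((n : ℝ) * (Nat.choose (n - 1) m : ℝ))) = 1 / n := by
    intro m hm
    have : ((n - 1).choose m : ℝ) ≠ 0 := by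
      exact_mod_cast (Nat.choose_pos (by have := Finset.mem_range.1 hm; omega)).ne'
    rw [nsmul_eq_mul]
    field_simp
  rw [Finset.sum_congr rfl this]
  simp [hn.ne']

lemma wgt_nonneg (n : ℕ) (S : Finset (Fin n)) : 0 ≤ wgt n S := by
  unfold wgt; positivity

lemma harm_pos {n : ℕ} (hn : 0 < n) : 0 < harm n :=
  Finset.sum_pos (fun k _ => by positivity) ⟨0, Finset.mem_range.2 hn⟩

lemma Pplus_nonneg (n : ℕ) (S : Finset (Fin n)) : 0 ≤ Pplus n S := by
  have : 0 ≤ harm n := Finset.sum_nonneg fun k _ => by positivity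
  unfold Pplus; positivity

lemma Pminus_compl (n : ℕ) (S : Finset (Fin n)) : Pminus n Sᶜ = Pplus n S := by
  have hS : S.card ≤ n := by simpa using S.card_le_univ
  unfold Pminus Pplus
  rw [Finset.card_compl, Fintype.card_fin, Nat.choose_symm hS, Nat.cast_sub hS, sub_sub_cancel]

lemma Pminus_nonneg (n : ℕ) (S : Finset (Fin n)) : 0 ≤ Pminus n S := by
  rw [← compl_compl S, Pminus_compl]; exact Pplus_nonneg n _

lemma sum_Pplus {n : ℕ} (hn : 0 < n) : ∑ S, Pplus n S = 1 := by
  have hH := harm_pos hn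
  have h := Finset.sum_powerset_apply_card
    (fun m => 1 / ((m : ℝ) * (Nat.choose n m : ℝ) * harm n)) (x := (Finset.univ : Finset (Fin n)))
  unfold Pplus
  rw [Finset.powerset_univ] at h
  rw [h, Finset.card_univ, Fintype.card_fin, Finset.sum_range_succ']
  have : ∀ m ∈ Finset.range n, n.choose (m + 1) •
      (1 / (((m + 1 : ℕ) : ℝ) * (Nat.choose n (m + 1) : ℝ) * harm n)) =
      1 / ((m : ℝ) + 1) / harm n := by
    intro m hm
    have : (n.choose (m + 1) : ℝ) ≠ 0 := by
      exact_mod_cast (Nat.choose_pos (Finset.mem_range.1 hm)).ne'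
    rw [nsmul_eq_mul]
    push_cast
    field_simp
  rw [Finset.sum_congr rfl this, ← Finset.sum_div]
  simp only [Nat.cast_zero, zero_mul, div_zero, smul_zero, add_zero]
  exact div_self hH.ne'

lemma sum_Pminus {n : ℕ} (hn : 0 < n) : ∑ S, Pminus n S = 1 := by
  rw [← sum_Pplus hn, ← Equiv.sum_comp (compl_involutive (α := Finset (Fin n))).toPerm]
  exact Finset.sum_congr rfl fun S _ => Pminus_compl n S

lemma Pplus_insert {n : ℕ} {i : Fin n} {S : Finset (Fin n)} (hS : S ∈ (Ni n i).powerset) :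
    Pplus n (insert i S) = wgt n S / harm n := by
  have hi := notMem_of_mem_powerset_Ni hS
  obtain ⟨m, rfl⟩ : ∃ m, n = m + 1 := ⟨n - 1, by have := i.pos; omega⟩
  have h : ((m + 1 : ℕ) : ℝ) * (m.choose S.card : ℝ) =
      ((m + 1).choose (S.card + 1) : ℝ) * (S.card + 1 : ℕ) := by
    exact_mod_cast Nat.add_one_mul_choose_eq m S.card
  unfold Pplus wgt
  rw [Finset.card_insert_of_notMem hi, Nat.add_sub_cancel, h, div_div,
    mul_comm ((S.card + 1 : ℕ) : ℝ)]

lemma Pminus_eq_wgt_div {n : ℕ} {i : Fin n} {S : Finset (Fin n)}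
    (hS : S ∈ (Ni n i).powerset) : Pminus n S = wgt n S / harm n := by
  have hc := card_add_one_le_of_mem_powerset_Ni hS
  obtain ⟨m, rfl⟩ : ∃ m, n = m + 1 := ⟨n - 1, by omega⟩
  have h : (m.choose S.card : ℝ) * (m + 1 : ℕ) =
      ((m + 1).choose S.card : ℝ) * (m + 1 - S.card : ℕ) := by
    exact_mod_cast Nat.choose_mul_succ_eq m S.card
  rw [Nat.cast_sub (by omega)] at h
  unfold Pminus wgt
  rw [Nat.add_sub_cancel, mul_comm ((m + 1 : ℕ) : ℝ) (m.choose _ : ℝ), h, div_div,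
    mul_comm (((m + 1 : ℕ) : ℝ) - _)]

lemma sum_eq_sum_powerset_Ni {n : ℕ} (i : Fin n) (f : Finset (Fin n) → ℝ) :
    ∑ S, f S = ∑ S ∈ (Ni n i).powerset, f S + ∑ S ∈ (Ni n i).powerset, f (insert i S) := by
  rw [← Finset.sum_powerset_insert (by simp [Ni])]
  simp [Ni, Finset.insert_erase]

lemma sum_Pplus_mul_ite {n : ℕ} (i : Fin n) (f : Finset (Fin n) → ℝ) :
    ∑ S, Pplus n S * (if i ∈ S then f S else 0) =
      (∑ S ∈ (Ni n i).powerset, wgt n S * f (insert i S)) / harm n := by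
  rw [sum_eq_sum_powerset_Ni i, Finset.sum_eq_zero, zero_add, Finset.sum_div]
  · refine Finset.sum_congr rfl fun S hS => ?_
    rw [Pplus_insert hS, if_pos (Finset.mem_insert_self i S)]
    ring
  · intro S hS
    rw [if_neg (notMem_of_mem_powerset_Ni hS), mul_zero]

lemma sum_Pminus_mul_ite {n : ℕ} (i : Fin n) (f : Finset (Fin n) → ℝ) :
    ∑ S, Pminus n S * (if i ∉ S then f S else 0) =
      (∑ S ∈ (Ni n i).powerset, wgt n S * f S) / harm n := by
  rw [sum_eq_sum_powerset_Ni i, add_comm, Finset.sum_eq_zero, zero_add, Finset.sum_div]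
  · refine Finset.sum_congr rfl fun S hS => ?_
    rw [Pminus_eq_wgt_div hS, if_pos (notMem_of_mem_powerset_Ni hS)]
    ring
  · intro S _
    rw [if_neg (not_not.2 (Finset.mem_insert_self i S)), mul_zero]

lemma sum_wgt_mul_sub (n : ℕ) (i : Fin n) (f : Finset (Fin n) → ℝ) :
    ∑ S ∈ (Ni n i).powerset, wgt n S * (f S - ∑ T ∈ (Ni n i).powerset, wgt n T * f T) = 0 := by
  simp only [mul_sub, Finset.sum_sub_distrib]
  rw [← Finset.sum_mul, sum_wgt, one_mul, sub_self]

lemma add_sum_filter_div_sub {K : ℕ} (Q : Fin K → Prop) [DecidablePred Q] (a c : ℝ)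
    (f : Fin K → ℝ) :
    (a + ∑ k ∈ Finset.univ.filter Q, f k) / ((1 + (Finset.univ.filter Q).card : ℕ) : ℝ) - c =
      ((a - c) + ∑ k, if Q k then f k - c else 0) / (1 + ∑ k, if Q k then (1 : ℝ) else 0) := by
  rw [← Finset.sum_filter, Finset.sum_sub_distrib, Finset.sum_boole, Finset.sum_const,
    nsmul_eq_mul]
  push_cast
  field_simp
  ring

lemma shapley_eq_sub (n : ℕ) (ν : Finset (Fin n) → ℝ) (i : Fin n) :
    shapley n ν i = phiPlus n ν i - phiMinus n ν i := by
  simp [shapley, phiPlus, phiMinus, mul_sub, Finset.sum_sub_distrib]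

/-- Corollary 4.3: with `T̄ = 2K`, `E[(φ̂_i − φ_i)²] ≤ (2Hₙ/T̄)·(σ_i⁺² + σ_i⁻²)`. -/
theorem stmt12 (n K : ℕ) (hn : 1 ≤ n) (hK : 1 ≤ K) (ν : Finset (Fin n) → ℝ)
    (hν : ν ∅ = 0) (i : Fin n) :
    expVal n K i (fun ω => (phiHat n K ν i ω - shapley n ν i) ^ 2)
      ≤ 2 * harm n / (2 * (K : ℝ)) * (sigPlusSq n ν i + sigMinusSq n ν i) := by
  have hH := harm_pos hn
  have hu : ∑ S, warmupP n i S = 1 := by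
    simpa [sum_wgt] using sum_warmupP_mul n i fun _ => 1
  set dp : Finset (Fin n) → ℝ := fun S => if i ∈ S then 1 else 0 with hdp
  set tp : Finset (Fin n) → ℝ := fun S => if i ∈ S then ν S - phiPlus n ν i else 0 with htp
  set gp : Finset (Fin n) → ℝ := fun S => ν (insert i S) - phiPlus n ν i with hgp
  set dm : Finset (Fin n) → ℝ := fun S => if i ∉ S then 1 else 0 with hdm
  set tm : Finset (Fin n) → ℝ := fun S => if i ∉ S then ν S - phiMinus n ν i else 0 with htm
  set gm : Finset (Fin n) → ℝ := fun S => ν S - phiMinus n ν i with hgm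
  have cp : ∀ S, dp S = 0 ∧ tp S = 0 ∨ dp S = 1 := fun S => by
    by_cases h : i ∈ S <;> simp [hdp, htp, h]
  have cm : ∀ S, dm S = 0 ∧ tm S = 0 ∨ dm S = 1 := fun S => by
    by_cases h : i ∈ S <;> simp [hdm, htm, h]
  have mean_gp : ∑ S, warmupP n i S * gp S = 0 := by
    rw [sum_warmupP_mul]
    exact sum_wgt_mul_sub n i fun S => ν (insert i S)
  have mean_gm : ∑ S, warmupP n i S * gm S = 0 := by
    rw [sum_warmupP_mul]
    exact sum_wgt_mul_sub n i ν
  have mean_tp : ∑ S, Pplus n S * tp S = 0 := by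
    rw [sum_Pplus_mul_ite i fun S => ν S - phiPlus n ν i, ← sum_warmupP_mul, mean_gp, zero_div]
  have sq_tp : ∑ S, Pplus n S * tp S ^ 2 = sigPlusSq n ν i * (1 / harm n) := by
    simp only [htp, ite_pow, ne_eq, OfNat.ofNat_ne_zero, not_false_eq_true, zero_pow]
    rw [sum_Pplus_mul_ite i fun S => (ν S - phiPlus n ν i) ^ 2, mul_one_div]
    rfl
  have sq_tm : ∑ S, Pminus n S * tm S ^ 2 = sigMinusSq n ν i * (1 / harm n) := by
    simp only [htm, ite_pow, ne_eq, OfNat.ofNat_ne_zero, not_false_eq_true, zero_pow]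
    rw [sum_Pminus_mul_ite i fun S => (ν S - phiMinus n ν i) ^ 2, mul_one_div]
    rfl
  have mean_tm : ∑ S, Pminus n S * tm S = 0 := by
    rw [sum_Pminus_mul_ite i fun S => ν S - phiMinus n ν i, ← sum_warmupP_mul, mean_gm, zero_div]
  have prob_dp : ∑ S, Pplus n S * dp S = 1 / harm n := by
    rw [sum_Pplus_mul_ite i fun _ => 1]; simp [sum_wgt]
  have prob_dm : ∑ S, Pminus n S * dm S = 1 / harm n := by
    rw [sum_Pminus_mul_ite i fun _ => 1]; simp [sum_wgt]
  have vp : 0 ≤ sigPlusSq n ν i :=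
    Finset.sum_nonneg fun S _ => mul_nonneg (wgt_nonneg n S) (sq_nonneg _)
  have vm : 0 ≤ sigMinusSq n ν i :=
    Finset.sum_nonneg fun S _ => mul_nonneg (wgt_nonneg n S) (sq_nonneg _)
  have bp := sum_prodExp_sq_mean_le (Pplus_nonneg n) (sum_Pplus hn) cp mean_tp prob_dp
    (by positivity) sq_tp vp hu (sum_warmupP_mul n i fun S => gp S ^ 2) hK
  have bm := sum_prodExp_sq_mean_le (Pminus_nonneg n) (sum_Pminus hn) cm mean_tm prob_dm
    (by positivity) sq_tm vm hu (sum_warmupP_mul n i fun S => gm S ^ 2) hK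
  have zp := sum_prodExp_mean_eq_zero cp mean_tp mean_gp K
  have totp := prodExp_one (sum_Pplus hn) K
  have totm := prodExp_one (sum_Pminus hn) K
  simp only [prodExp, Finset.mul_sum, mul_one] at bp bm zp totp totm
  have split := sum_mul_sub_sq_of_mean_zero
    (F := fun x : Finset (Fin n) × (Fin K → Finset (Fin n)) =>
      warmupP n i x.1 * ∏ k, Pplus n (x.2 k))
    (G := fun y : Finset (Fin n) × (Fin K → Finset (Fin n)) =>
      warmupP n i y.1 * ∏ k, Pminus n (y.2 k))
    (X := fun x => (gp x.1 + ∑ k, tp (x.2 k)) / (1 + ∑ k, dp (x.2 k)))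
    (Y := fun y => (gm y.1 + ∑ k, tm (y.2 k)) / (1 + ∑ k, dm (y.2 k)))
    (by simp [Fintype.sum_prod_type, ← Finset.mul_sum, totp, hu])
    (by simp [Fintype.sum_prod_type, ← Finset.mul_sum, totm, hu])
    (by simpa only [Fintype.sum_prod_type, mul_assoc] using zp)
  have expand : expVal n K i (fun ω => (phiHat n K ν i ω - shapley n ν i) ^ 2) =
      ∑ x : Finset (Fin n) × (Fin K → Finset (Fin n)),
        ∑ y : Finset (Fin n) × (Fin K → Finset (Fin n)),
          warmupP n i x.1 * (∏ k, Pplus n (x.2 k)) *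
            (warmupP n i y.1 * ∏ k, Pminus n (y.2 k)) *
            ((gp x.1 + ∑ k, tp (x.2 k)) / (1 + ∑ k, dp (x.2 k)) -
              (gm y.1 + ∑ k, tm (y.2 k)) / (1 + ∑ k, dm (y.2 k))) ^ 2 := by
    simp only [expVal, Fintype.sum_prod_type]
    refine Finset.sum_congr rfl fun b _ => ?_
    rw [Finset.sum_comm]
    refine Finset.sum_congr rfl fun A _ => Finset.sum_congr rfl fun c _ =>
      Finset.sum_congr rfl fun C _ => ?_
    have e : phiHat n K ν i (b, c, A, C) - shapley n ν i =
        (phiHatPlus n K ν i (b, c, A, C) - phiPlus n ν i) -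
          (phiHatMinus n K ν i (b, c, A, C) - phiMinus n ν i) := by
      rw [phiHat, shapley_eq_sub]; ring
    rw [e, phiHatPlus, phiHatMinus, mplus, mminus, add_sum_filter_div_sub,
      add_sum_filter_div_sub]
    simp only [jointP, warmupP]
    ring
  rw [expand, split]
  simp only [Fintype.sum_prod_type, mul_assoc]
  refine (add_le_add bp bm).trans_eq ?_
  field_simp
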